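/- arXiv:1801.02405 — 6 statements merged into one kernel-verified Lean document; each statement's English description precedes it below -/
import Mathlib

section
/- Let G be a connected, locally finite graph and let v and w be vertices of G. Suppose there is a constant c such that for all n ∈ ℕ we have |B_w(n+1)| < c·|B_w(n)|. If G has 2-distinguishing density zero at v, then G has 2-distinguishing density zero. -/
open Filter SimpleGraph

/-- The ball of radius `n` around `v`: all vertices at distance at most `n` from `v`. -/
def gball {V : Type*} (G : SimpleGraph V) (v : V) (n : ℕ) : Set V :=
  {x | G.dist v x ≤ n}

/-- The sphere of radius `n` around `v`: all vertices at distance exactly `n` from `v`. -/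
def gsphere {V : Type*} (G : SimpleGraph V) (v : V) (n : ℕ) : Set V :=
  {x | G.dist v x = n}

/-- A 2-coloring (vertices colored by `Bool`) is distinguishing if the identity is the
only automorphism preserving it. -/
def Distinguishing {V : Type*} (G : SimpleGraph V) (l : V → Bool) : Prop :=
  ∀ g : G ≃g G, (∀ x, l (g x) = l x) → ∀ x, g x = x

/-- The set `W` has density zero at `v`:
`|B_v(n) ∩ W| / |B_v(n)| → 0` as `n → ∞`. -/
def DensityZeroAt {V : Type*} (G : SimpleGraph V) (W : Set V) (v : V) : Prop :=
  Tendsto (fun n : ℕ => ((gball G v n ∩ W).ncard : ℝ) / ((gball G v n).ncard : ℝ))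
    atTop (nhds 0)

theorem gball_finite {V : Type*} {G : SimpleGraph V} (hconn : G.Connected)
    (hlf : ∀ x : V, (G.neighborSet x).Finite) (n : ℕ) (v : V) : (gball G v n).Finite := by
  induction n generalizing v with
  | zero =>
    refine (Set.finite_singleton v).subset fun x hx => ?_
    exact (hconn.dist_eq_zero_iff.mp (Nat.le_zero.mp hx)).symm
  | succ n ih =>
    refine ((Set.finite_singleton v).union ((hlf v).biUnion fun y _ => ih y)).subset fun x hx => ?_
    obtain ⟨p, hp⟩ := hconn.exists_walk_length_eq_dist v x
    have hx' : G.dist v x ≤ n + 1 := hx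
    cases p with
    | nil => exact Or.inl rfl
    | @cons _ y _ h q =>
      refine Or.inr (Set.mem_biUnion h ?_)
      have hq := dist_le q
      rw [Walk.length_cons] at hp
      change G.dist y x ≤ n
      omega

theorem gball_subset_gball {V : Type*} {G : SimpleGraph V} (hconn : G.Connected) {u v : V}
    {m n : ℕ} (h : G.dist v u + m ≤ n) : gball G u m ⊆ gball G v n := fun x hx => by
  have hx' : G.dist u x ≤ m := hx
  have := hconn.dist_triangle (u := v) (v := u) (w := x)
  change G.dist v x ≤ n
  omega

theorem ncard_gball_pos {V : Type*} {G : SimpleGraph V} (hconn : G.Connected)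
    (hlf : ∀ x : V, (G.neighborSet x).Finite) (v : V) (n : ℕ) : 0 < (gball G v n).ncard :=
  (Set.ncard_pos (gball_finite hconn hlf n v)).mpr ⟨v, by simp [gball]⟩

/-- If the balls around `w` grow at most by the factor `c` in each step, then density zero
at one vertex implies density zero at every vertex. -/
theorem DensityZeroAt.of_growth {V : Type*} {G : SimpleGraph V} (hconn : G.Connected)
    (hlf : ∀ x : V, (G.neighborSet x).Finite) {v w : V} {c : ℝ} (hc0 : 0 ≤ c)
    (hc : ∀ n : ℕ, ((gball G w (n + 1)).ncard : ℝ) ≤ c * ((gball G w n).ncard : ℝ))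
    {W : Set V} (hW : DensityZeroAt G W v) (u : V) : DensityZeroAt G W u := by
  have growth (m k : ℕ) :
      ((gball G w (m + k)).ncard : ℝ) ≤ c ^ k * ((gball G w m).ncard : ℝ) := by
    induction k with
    | zero => simp
    | succ k ih =>
      calc ((gball G w (m + (k + 1))).ncard : ℝ) ≤ c * ((gball G w (m + k)).ncard : ℝ) := hc _
        _ ≤ c * (c ^ k * ((gball G w m).ncard : ℝ)) := by gcongr
        _ = c ^ (k + 1) * ((gball G w m).ncard : ℝ) := by ring
  set d := G.dist v u
  set e := G.dist w v
  set f := G.dist u w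
  have hlim := ((tendsto_add_atTop_iff_nat d).mpr hW).const_mul (c ^ (f + d + e))
  rw [mul_zero] at hlim
  refine squeeze_zero' (Eventually.of_forall fun n => by positivity) ?_ hlim
  filter_upwards [eventually_ge_atTop f] with n hn
  have hnum : ((gball G u n ∩ W).ncard : ℝ) ≤ ((gball G v (n + d) ∩ W).ncard : ℝ) := by
    exact_mod_cast Set.ncard_le_ncard
      (Set.inter_subset_inter_left W (gball_subset_gball hconn (by omega)))
      ((gball_finite hconn hlf _ v).inter_of_left W)
  have hden : ((gball G v (n + d)).ncard : ℝ) ≤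
      c ^ (f + d + e) * ((gball G u n).ncard : ℝ) := by
    calc ((gball G v (n + d)).ncard : ℝ)
        ≤ ((gball G w (n - f + (f + d + e))).ncard : ℝ) := by
          exact_mod_cast Set.ncard_le_ncard (gball_subset_gball hconn (by omega))
            (gball_finite hconn hlf _ w)
      _ ≤ c ^ (f + d + e) * ((gball G w (n - f)).ncard : ℝ) := growth _ _
      _ ≤ c ^ (f + d + e) * ((gball G u n).ncard : ℝ) := by
          gcongr
          · exact gball_finite hconn hlf n u
          · exact gball_subset_gball hconn (by omega)
  have hu : (0 : ℝ) < (gball G u n).ncard := by exact_mod_cast ncard_gball_pos hconn hlf u n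
  have hv : (0 : ℝ) < (gball G v (n + d)).ncard := by
    exact_mod_cast ncard_gball_pos hconn hlf v (n + d)
  rw [mul_div_assoc', div_le_div_iff₀ hu hv]
  calc ((gball G u n ∩ W).ncard : ℝ) * ((gball G v (n + d)).ncard : ℝ)
      ≤ ((gball G v (n + d) ∩ W).ncard : ℝ) *
          (c ^ (f + d + e) * ((gball G u n).ncard : ℝ)) := by gcongr
    _ = c ^ (f + d + e) * ((gball G v (n + d) ∩ W).ncard : ℝ) *
          ((gball G u n).ncard : ℝ) := by ring

/-- Let `G` be a connected, locally finite graph and `v, w` vertices.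
If there is a constant `c` with `|B_w(n+1)| < c·|B_w(n)|` for all `n`, and `G` has
2-distinguishing density zero at `v`, then `G` has 2-distinguishing density zero. -/
theorem stmt_0 {V : Type*} (G : SimpleGraph V) (hconn : G.Connected)
    (hlf : ∀ x : V, (G.neighborSet x).Finite) (v w : V) (c : ℝ)
    (hc : ∀ n : ℕ, ((gball G w (n + 1)).ncard : ℝ) < c * ((gball G w n).ncard : ℝ))
    (hv : ∃ l : V → Bool, Distinguishing G l ∧
      ∃ b : Bool, DensityZeroAt G {x | l x = b} v) :
    ∃ l : V → Bool, Distinguishing G l ∧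
      ∃ b : Bool, ∀ u : V, DensityZeroAt G {x | l x = b} u := by
  obtain ⟨l, hl, b, hb⟩ := hv
  have hc0 : 0 ≤ c :=
    (pos_of_mul_pos_left ((Nat.cast_nonneg _).trans_lt (hc 0)) (Nat.cast_nonneg _)).le
  exact ⟨l, hl, b, hb.of_growth hconn hlf hc0 fun n => (hc n).le⟩
end

section
/- There exists a countably infinite, connected, locally finite graph G and a vertex v of G such that G has 2-distinguishing density zero at v, but G does not have 2-distinguishing density zero (i.e., for every distinguishing 2-coloring of G there is a vertex v' at which neither color class has density zero). -/
open Filter SimpleGraph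

namespace SimpleGraph

variable {V U : Type*}

/-- Swapping two vertices with the same neighbourhood is an automorphism. -/
def swapTwins [DecidableEq V] (G : SimpleGraph V) {x y : V}
    (h : ∀ z, G.Adj x z ↔ G.Adj y z) : G ≃g G where
  toEquiv := Equiv.swap x y
  map_rel_iff' := by
    have key : ∀ w z, G.Adj (Equiv.swap x y w) z ↔ G.Adj w z := by
      intro w z
      rw [Equiv.swap_apply_def]
      split_ifs with h1 h2
      · rw [h1, h z]
      · rw [h2, h z]
      · rfl
    intro a b
    rw [key, adj_comm, key, adj_comm]

theorem _root_.Distinguishing.ne_of_twins {G : SimpleGraph V} {l : V → Bool}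
    (hl : Distinguishing G l) {x y : V} (hxy : x ≠ y) (h : ∀ z, G.Adj x z ↔ G.Adj y z) :
    l x ≠ l y := by
  classical
  intro hc
  refine hxy ?_
  have := hl (swapTwins G h) (fun z => ?_) y
  · simpa [swapTwins] using this
  · change l (Equiv.swap x y z) = l z
    rw [Equiv.swap_apply_def]
    split_ifs with h1 h2
    · rw [h1, hc]
    · rw [h2, hc]
    · rfl

theorem gball_subset_of_adj {G : SimpleGraph V} (hG : G.Connected) {S : ℕ → Set V} {u : V}
    (h0 : u ∈ S 0) (hmono : ∀ k, S k ⊆ S (k + 1))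
    (hadj : ∀ k x y, x ∈ S k → G.Adj x y → y ∈ S (k + 1)) (n : ℕ) :
    gball G u n ⊆ S n := by
  have walk : ∀ {a b : V} (p : G.Walk a b) (m : ℕ), a ∈ S m → b ∈ S (m + p.length) := by
    intro a b p
    induction p with
    | nil => intro m hm; simpa using hm
    | cons h p ih =>
      intro m hm
      have := ih (m + 1) (hadj m _ _ hm h)
      rwa [Walk.length_cons, Nat.add_comm p.length 1, ← Nat.add_assoc]
  intro x hx
  obtain ⟨p, hp⟩ := hG.exists_walk_length_eq_dist u x
  have h := walk p 0 h0
  rw [Nat.zero_add, hp] at h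
  exact monotone_nat_of_le_succ hmono hx h

theorem Iso.dist_map {G : SimpleGraph V} {H : SimpleGraph U} (φ : G ≃g H) (x y : V) :
    H.dist (φ x) (φ y) = G.dist x y := by
  rw [dist_eq_sInf, dist_eq_sInf]
  congr 1
  ext n
  constructor
  · rintro ⟨p, rfl⟩
    exact ⟨(p.map φ.symm.toHom).copy (φ.symm_apply_apply x) (φ.symm_apply_apply y), by simp⟩
  · rintro ⟨p, rfl⟩
    exact ⟨p.map φ.toHom, by simp⟩

theorem _root_.DensityZeroAt.of_iso {G : SimpleGraph V} {H : SimpleGraph U} (φ : G ≃g H)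
    {W : Set U} {v : V} (h : DensityZeroAt H W (φ v)) : DensityZeroAt G (φ ⁻¹' W) v := by
  have key : ∀ S : Set U, (φ ⁻¹' S).ncard = S.ncard := fun S =>
    Set.ncard_preimage_of_injective_subset_range φ.injective
      (by rw [φ.surjective.range_eq]; exact Set.subset_univ S)
  have hball : ∀ n, gball G v n = φ ⁻¹' gball H (φ v) n := fun n => by
    ext x; simp [gball, φ.dist_map]
  unfold DensityZeroAt at h ⊢
  simpa only [hball, ← Set.preimage_inter, key] using h

theorem _root_.Distinguishing.of_iso {G : SimpleGraph V} {H : SimpleGraph U} (φ : G ≃g H)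
    {l : U → Bool} (h : Distinguishing H l) : Distinguishing G (l ∘ φ) := by
  intro g hg x
  have := h ((φ.symm.trans g).trans φ) (fun y => by simpa using hg (φ.symm y)) (φ x)
  simpa using this

/-- The number of neighbours of a vertex `x` in a set `S`. -/
noncomputable def degreeIn (G : SimpleGraph V) (S : Set V) (x : V) : ℕ :=
  (G.neighborSet x ∩ S).ncard

theorem degreeIn_apply_iso {G : SimpleGraph V} (g : G ≃g G) {l : V → Bool}
    (hg : ∀ x, l (g x) = l x) (b : Bool) (x : V) :
    G.degreeIn {y | l y = b} (g x) = G.degreeIn {y | l y = b} x := by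
  unfold degreeIn
  rw [← Set.ncard_image_of_injective (G.neighborSet x ∩ _) g.injective]
  congr 1
  ext y
  obtain ⟨z, rfl⟩ := g.surjective y
  rw [g.injective.mem_set_image]
  exact and_congr g.map_adj_iff (by rw [Set.mem_ofPred_eq, Set.mem_ofPred_eq, hg])

end SimpleGraph

namespace TwinGraph

/-- Two distinct numbers are linked when each is smaller than the square of two more than
the other. -/
def Link (i j : ℕ) : Prop := i ≠ j ∧ i < (j + 2) ^ 2 ∧ j < (i + 2) ^ 2

theorem Link.symm {i j : ℕ} (h : Link i j) : Link j i := ⟨h.1.symm, h.2.2, h.2.1⟩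

theorem not_link_self (i : ℕ) : ¬ Link i i := fun h => h.1 rfl

theorem link_of_lt {i j : ℕ} (h : i < j) (hj : j < (i + 2) ^ 2) : Link i j :=
  ⟨h.ne, by nlinarith, hj⟩

theorem setOf_link (j : ℕ) :
    {i | Link j i} = ((Finset.Ico (Nat.sqrt j - 1) ((j + 2) ^ 2)).erase j : Finset ℕ) := by
  ext i
  have : j < (i + 2) ^ 2 ↔ Nat.sqrt j < i + 2 := Nat.sqrt_lt'.symm
  simp only [Link, Set.mem_ofPred_eq, this, Finset.coe_erase, Finset.coe_Ico, Set.mem_sdiff,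
    Set.mem_Ico, Set.mem_singleton_iff]
  omega

theorem finite_setOf_link (j : ℕ) : {i | Link j i}.Finite := by
  rw [setOf_link]; exact Finset.finite_toSet _

theorem ncard_setOf_link (j : ℕ) :
    {i | Link j i}.ncard = (j + 2) ^ 2 - (Nat.sqrt j - 1) - 1 := by
  have h1 := Nat.sqrt_le_self j
  rw [setOf_link, Set.ncard_coe_finset, Finset.card_erase_of_mem, Nat.card_Ico]
  rw [Finset.mem_Ico]
  constructor
  · omega
  · nlinarith

theorem ncard_setOf_link_lt {i j : ℕ} (h : i < j) :
    {k | Link i k}.ncard + 1 < {k | Link j k}.ncard := by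
  rw [ncard_setOf_link, ncard_setOf_link]
  have h1 := Nat.sqrt_le_self j
  have h2 : (i + 2) ^ 2 + 2 * j + 3 ≤ (j + 2) ^ 2 := by nlinarith
  have h3 : 1 ≤ (i + 2) ^ 2 := Nat.one_le_pow _ _ (by omega)
  omega

theorem two_le_ncard_setOf_link (j : ℕ) : 2 ≤ {k | Link j k}.ncard := by
  rcases Nat.eq_zero_or_pos j with rfl | h
  · rw [ncard_setOf_link]; norm_num
  · have h0 := ncard_setOf_link_lt h
    rw [ncard_setOf_link 0] at h0
    norm_num at h0
    omega

/-- One copy of the graph `Link` (tag `none`) and a second one with every vertex replaced by a pair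
of twins (tags `some true` and `some false`), joined at the vertices with index zero. -/
def graph : SimpleGraph (Option Bool × ℕ) where
  Adj x y := (x.1.isSome = y.1.isSome ∧ Link x.2 y.2) ∨
    (x.1.isSome ≠ y.1.isSome ∧ x.2 = 0 ∧ y.2 = 0)
  symm := ⟨by
    rintro x y (⟨h1, h2⟩ | ⟨h1, h2, h3⟩)
    · exact Or.inl ⟨h1.symm, h2.symm⟩
    · exact Or.inr ⟨h1.symm, h3, h2⟩⟩
  loopless := ⟨by
    rintro x (⟨-, h⟩ | ⟨h, -⟩)
    · exact not_link_self _ h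
    · exact h rfl⟩

theorem graph_adj {x y : Option Bool × ℕ} : graph.Adj x y ↔
    (x.1.isSome = y.1.isSome ∧ Link x.2 y.2) ∨
      (x.1.isSome ≠ y.1.isSome ∧ x.2 = 0 ∧ y.2 = 0) := Iff.rfl

/-- The largest index reached within `k` steps from index zero. -/
def reach : ℕ → ℕ
  | 0 => 0
  | k + 1 => (reach k + 2) ^ 2 - 1

theorem reach_succ_add_one (k : ℕ) : reach (k + 1) + 1 = (reach k + 2) ^ 2 := by
  have : 1 ≤ (reach k + 2) ^ 2 := Nat.one_le_pow _ _ (by omega)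
  rw [reach]; omega

theorem reach_lt_succ (k : ℕ) : reach k < reach (k + 1) := by
  have := reach_succ_add_one k
  nlinarith

theorem le_reach (k : ℕ) : k ≤ reach k := by
  induction k with
  | zero => exact Nat.zero_le _
  | succ k ih => have := reach_lt_succ k; omega

theorem le_reach_succ_of_link {i j k : ℕ} (hi : i ≤ reach k) (h : Link i j) :
    j ≤ reach (k + 1) := by
  have h1 := reach_succ_add_one k
  have h2 := h.2.2
  have : (i + 2) ^ 2 ≤ (reach k + 2) ^ 2 := Nat.pow_le_pow_left (by omega) 2
  omega

theorem exists_walk_length_le {a a' : Option Bool} (ha : a.isSome = a'.isSome) (k j : ℕ)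
    (hj : j ≤ reach k) (h0 : j = 0 → a' = a) :
    ∃ p : graph.Walk (a, 0) (a', j), p.length ≤ k := by
  induction k generalizing a' j with
  | zero =>
    obtain rfl : j = 0 := Nat.le_zero.mp hj
    obtain rfl := h0 rfl
    exact ⟨.nil, le_rfl⟩
  | succ k ih =>
    by_cases hk : j ≤ reach k
    · obtain ⟨p, hp⟩ := ih ha j hk h0
      exact ⟨p, by omega⟩
    · obtain ⟨p, hp⟩ := ih (a' := a) rfl (reach k) le_rfl (fun _ => rfl)
      have hr := reach_succ_add_one k
      have hadj : graph.Adj (a, reach k) (a', j) :=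
        Or.inl ⟨ha, link_of_lt (not_le.mp hk) (by simp only; omega)⟩
      exact ⟨p.concat hadj, by rw [Walk.length_concat]; omega⟩

theorem mem_gball {a a' : Option Bool} (ha : a.isSome = a'.isSome) {k j : ℕ}
    (hj : j ≤ reach k) (h0 : j = 0 → a' = a) : (a', j) ∈ gball graph (a, 0) k := by
  obtain ⟨p, hp⟩ := exists_walk_length_le ha k j hj h0
  exact (dist_le p).trans hp

theorem graph_connected : graph.Connected := by
  have h : ∀ x : Option Bool × ℕ, graph.Reachable (none, 0) x := by
    rintro ⟨a, j⟩
    obtain ⟨p, -⟩ := exists_walk_length_le (a := a) (a' := a) rfl j j (le_reach j) (fun _ => rfl)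
    refine Reachable.trans ?_ ⟨p⟩
    cases a with
    | none => exact Reachable.refl _
    | some t => exact Adj.reachable (Or.inr ⟨by simp, rfl, rfl⟩)
  have : Nonempty (Option Bool × ℕ) := ⟨(none, 0)⟩
  exact ⟨fun x y => (h x).symm.trans (h y)⟩

theorem finite_neighborSet (x : Option Bool × ℕ) : (graph.neighborSet x).Finite := by
  refine (Set.finite_univ.prod ((finite_setOf_link x.2).union (Set.finite_singleton 0))).subset ?_
  rintro y (⟨-, h⟩ | ⟨-, -, h⟩)
  · exact ⟨Set.mem_univ _, Or.inl h⟩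
  · exact ⟨Set.mem_univ _, Or.inr h⟩

theorem gball_subset (a : Option Bool) (k : ℕ) :
    gball graph (a, 0) k ⊆ {x | x.2 ≤ reach k} := by
  refine gball_subset_of_adj (S := fun k => {x | x.2 ≤ reach k}) graph_connected
    (Nat.zero_le _) (fun k x hx => le_trans hx (reach_lt_succ k).le) ?_ k
  rintro k x y hx (⟨-, h⟩ | ⟨-, -, h⟩)
  · exact le_reach_succ_of_link hx h
  · simp [h]

theorem gball_none_subset (k : ℕ) :
    gball graph (none, 0) k ⊆ {x | x.2 ≤ reach k ∧ (x.1.isSome → x.2 ≤ reach (k - 1) ∧ 1 ≤ k)} := by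
  refine gball_subset_of_adj
    (S := fun k => {x | x.2 ≤ reach k ∧ (x.1.isSome → x.2 ≤ reach (k - 1) ∧ 1 ≤ k)})
    graph_connected ⟨Nat.zero_le _, by simp⟩ ?_ ?_ k
  · rintro k x ⟨hx, -⟩
    exact ⟨le_trans hx (reach_lt_succ k).le, fun _ => ⟨hx, by omega⟩⟩
  · rintro k x y ⟨hx, hx'⟩ (⟨hs, h⟩ | ⟨-, -, h⟩)
    · refine ⟨le_reach_succ_of_link hx h, fun hy => ⟨?_, by omega⟩⟩
      obtain ⟨h1, h2⟩ := hx' (hs.trans hy)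
      have := le_reach_succ_of_link h1 h
      rwa [Nat.sub_add_cancel h2] at this
    · simp [h]

theorem finite_setOf_snd_le (n : ℕ) : {x : Option Bool × ℕ | x.2 ≤ n}.Finite :=
  (Set.finite_univ.prod (Set.finite_Iic n)).subset fun _ hx => ⟨Set.mem_univ _, hx⟩

theorem ncard_setOf_snd_le (n : ℕ) : {x : Option Bool × ℕ | x.2 ≤ n}.ncard = 3 * (n + 1) := by
  have : {x : Option Bool × ℕ | x.2 ≤ n} =
      ((Finset.univ ×ˢ Finset.Iic n : Finset (Option Bool × ℕ)) : Set (Option Bool × ℕ)) := by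
    ext x; simp
  rw [this, Set.ncard_coe_finset, Finset.card_product]
  simp

theorem finite_gball (a : Option Bool) (k : ℕ) : (gball graph (a, 0) k).Finite :=
  (finite_setOf_snd_le _).subset (gball_subset a k)

/-- The coloring that is `true` on exactly one vertex of each pair of twins. -/
def coloring (x : Option Bool × ℕ) : Bool := x.1 == some true

theorem coloring_eq_true {x : Option Bool × ℕ} : coloring x = true ↔ x.1 = some true := by
  simp [coloring]

theorem densityZeroAt_coloring : DensityZeroAt graph {x | coloring x = true} (none, 0) := by
  unfold DensityZeroAt
  rw [← tendsto_add_atTop_iff_nat 1]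
  refine squeeze_zero (fun _ => by positivity) (fun k => ?_)
    tendsto_one_div_add_atTop_nhds_zero_nat
  have hnum : (gball graph (none, 0) (k + 1) ∩ {x | coloring x = true}).ncard ≤ reach k + 1 := by
    have hsub : gball graph (none, 0) (k + 1) ∩ {x | coloring x = true} ⊆
        (fun j => (some true, j)) '' Set.Iic (reach k) := by
      rintro ⟨a, j⟩ ⟨hx, hc⟩
      obtain rfl : a = some true := coloring_eq_true.mp hc
      exact ⟨j, ((gball_none_subset _ hx).2 rfl).1, rfl⟩
    refine (Set.ncard_le_ncard hsub ((Set.finite_Iic _).image _)).trans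
      ((Set.ncard_image_le (Set.finite_Iic _)).trans ?_)
    rw [← Finset.coe_Iic, Set.ncard_coe_finset, Nat.card_Iic]
  have hden : (reach k + 2) ^ 2 ≤ (gball graph (none, 0) (k + 1)).ncard := by
    have hsub : (fun j => ((none : Option Bool), j)) '' Set.Iic (reach (k + 1)) ⊆
        gball graph (none, 0) (k + 1) := by
      rintro _ ⟨j, hj, rfl⟩
      exact mem_gball rfl hj fun _ => rfl
    have := Set.ncard_le_ncard hsub (finite_gball _ _)
    rw [Set.ncard_image_of_injective _ (Prod.mk_right_injective _), ← Finset.coe_Iic,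
      Set.ncard_coe_finset, Nat.card_Iic, reach_succ_add_one] at this
    exact this
  have hk := le_reach k
  have hpos : 0 < (reach k + 2) ^ 2 := by positivity
  rw [div_le_div_iff₀ (by exact_mod_cast hpos.trans_le hden) (by positivity)]
  norm_cast
  nlinarith

theorem not_densityZeroAt_of_distinguishing {l : Option Bool × ℕ → Bool}
    (hl : Distinguishing graph l) (b : Bool) :
    ¬ DensityZeroAt graph {x | l x = b} (some true, 0) := by
  have htwin : ∀ j, ∃ t, l (some t, j) = b := by
    intro j
    have := hl.ne_of_twins (x := (some true, j)) (y := (some false, j)) (by simp)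
      (fun z => by simp [graph_adj])
    by_contra! h
    have h1 := h true
    have h2 := h false
    exact this ((Bool.eq_not_of_ne h1).trans (Bool.eq_not_of_ne h2).symm)
  choose t ht using htwin
  intro h
  have hlt := (h.eventually (gt_mem_nhds (show (0 : ℝ) < 1 / 6 by norm_num))).and
    (eventually_ge_atTop 1)
  obtain ⟨k, hk, hk1⟩ := hlt.exists
  have hnum : reach k ≤ (gball graph (some true, 0) k ∩ {x | l x = b}).ncard := by
    have hsub : (fun j => (some (t j), j)) '' Set.Icc 1 (reach k) ⊆
        gball graph (some true, 0) k ∩ {x | l x = b} := by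
      rintro _ ⟨j, ⟨hj1, hj⟩, rfl⟩
      exact ⟨mem_gball (a := some true) (a' := some (t j)) rfl hj fun h0 => by omega, ht j⟩
    have := Set.ncard_le_ncard hsub ((finite_gball _ _).inter_of_left _)
    rw [Set.ncard_image_of_injective _ (fun i j hij => (Prod.ext_iff.mp hij).2),
      ← Finset.coe_Icc, Set.ncard_coe_finset, Nat.card_Icc] at this
    omega
  have hden := Set.ncard_le_ncard (gball_subset (some true) k) (finite_setOf_snd_le _)
  rw [ncard_setOf_snd_le] at hden
  have hpos : 0 < (gball graph (some true, 0) k).ncard :=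
    (Set.ncard_pos (finite_gball _ _)).mpr ⟨_, mem_gball rfl (Nat.zero_le _) fun _ => rfl⟩
  have hr := le_reach k
  rw [div_lt_div_iff₀ (by exact_mod_cast hpos) (by norm_num)] at hk
  norm_cast at hk
  omega

theorem degreeIn_true_some (t : Bool) (j : ℕ) :
    graph.degreeIn {x | coloring x = true} (some t, j) = {i | Link j i}.ncard := by
  unfold degreeIn
  rw [← Set.ncard_image_of_injective {i | Link j i} (Prod.mk_right_injective (some true))]
  congr 1
  ext ⟨a, i⟩
  simp only [Set.mem_inter_iff, mem_neighborSet, graph_adj, Set.mem_ofPred_eq, coloring_eq_true,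
    Set.mem_image, Prod.mk.injEq]
  aesop

theorem degreeIn_true_none (j : ℕ) :
    graph.degreeIn {x | coloring x = true} (none, j) ≤ 1 := by
  unfold degreeIn
  refine (Set.ncard_le_ncard (t := {(some true, 0)}) ?_).trans (Set.ncard_singleton _).le
  rintro ⟨a, i⟩ ⟨h, hc⟩
  obtain rfl : a = some true := coloring_eq_true.mp hc
  rcases h with ⟨h, -⟩ | ⟨-, -, rfl : i = 0⟩
  · simp at h
  · rfl

theorem degreeIn_false_none (j : ℕ) :
    graph.degreeIn {x | coloring x = false} (none, j) =
      {i | Link j i}.ncard + if j = 0 then 1 else 0 := by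
  have hinj : Function.Injective fun i : ℕ => ((none : Option Bool), i) :=
    Prod.mk_right_injective _
  rw [← Set.ncard_image_of_injective {i | Link j i} hinj]
  unfold degreeIn
  split_ifs with h
  · rw [← Set.ncard_insert_of_notMem (a := (some false, 0)) (by simp)
      ((finite_setOf_link j).image _)]
    congr 1
    ext ⟨_ | _ | _, i⟩ <;> simp [graph_adj, coloring, h]
  · congr 1
    ext ⟨_ | _ | _, i⟩ <;> simp [graph_adj, coloring, h]

theorem ncard_setOf_link_injective : Function.Injective fun j => {i | Link j i}.ncard :=
  StrictMono.injective fun _ _ h => by have := ncard_setOf_link_lt h; omega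

theorem distinguishing_coloring : Distinguishing graph coloring := by
  intro g hg x
  have hc := hg x
  have ht := degreeIn_apply_iso g hg true x
  have hf := degreeIn_apply_iso g hg false x
  generalize g x = y at hc ht hf
  obtain ⟨a, j⟩ := x
  obtain ⟨a', i⟩ := y
  cases a with
  | none =>
    cases a' with
    | none =>
      rw [degreeIn_false_none, degreeIn_false_none] at hf
      rcases lt_trichotomy i j with h | rfl | h
      · have := ncard_setOf_link_lt h
        split_ifs at hf <;> omega
      · rfl
      · have := ncard_setOf_link_lt h
        split_ifs at hf <;> omega
    | some t =>
      have h1 := degreeIn_true_none j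
      have h2 := two_le_ncard_setOf_link i
      rw [degreeIn_true_some] at ht
      omega
  | some s =>
    cases a' with
    | none =>
      have h1 := degreeIn_true_none i
      have h2 := two_le_ncard_setOf_link j
      rw [degreeIn_true_some] at ht
      omega
    | some t =>
      rw [degreeIn_true_some, degreeIn_true_some] at ht
      obtain rfl := ncard_setOf_link_injective ht
      have : t = s := by cases s <;> cases t <;> simp_all [coloring]
      rw [this]

end TwinGraph

/-- There is a countably infinite, connected, locally finite graph `G`
(on vertex set `ℕ`) and a vertex `v` such that `G` has 2-distinguishing density zero
at `v`, but `G` does not have 2-distinguishing density zero. -/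
theorem stmt_1 :
    ∃ (G : SimpleGraph ℕ) (v : ℕ),
      G.Connected ∧ (∀ x : ℕ, (G.neighborSet x).Finite) ∧
      (∃ l : ℕ → Bool, Distinguishing G l ∧
        ∃ b : Bool, DensityZeroAt G {x | l x = b} v) ∧
      ¬ (∃ l : ℕ → Bool, Distinguishing G l ∧
        ∃ b : Bool, ∀ u : ℕ, DensityZeroAt G {x | l x = b} u) := by
  obtain ⟨e⟩ : Nonempty (ℕ ≃ Option Bool × ℕ) := nonempty_equiv_of_countable
  let φ : TwinGraph.graph.comap e ≃g TwinGraph.graph := Iso.comap e TwinGraph.graph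
  refine ⟨TwinGraph.graph.comap e, e.symm (none, 0), φ.connected_iff.mpr TwinGraph.graph_connected,
    fun x => ?_, ⟨TwinGraph.coloring ∘ φ, TwinGraph.distinguishing_coloring.of_iso φ, true,
      DensityZeroAt.of_iso φ (W := {x | TwinGraph.coloring x = true}) ?_⟩, ?_⟩
  · exact (TwinGraph.finite_neighborSet (e x)).preimage e.injective.injOn
  · rw [show φ (e.symm (none, 0)) = (none, 0) from e.apply_symm_apply _]
    exact TwinGraph.densityZeroAt_coloring
  · rintro ⟨l, hl, b, h⟩
    refine TwinGraph.not_densityZeroAt_of_distinguishing (hl.of_iso φ.symm) b ?_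
    exact DensityZeroAt.of_iso φ.symm (W := {x | l x = b}) (h _)
end

section
/- Every countably infinite tree in which every vertex has degree at least 2 (i.e., a denumerable tree without leaves) is 2-distinguishable with density zero, i.e., it admits a distinguishing 2-coloring one of whose color classes W satisfies δ_v(W) = 0 for every vertex v. -/
open Filter SimpleGraph

namespace SimpleGraph

variable {V : Type*} {G : SimpleGraph V}

lemma Iso.dist_map_eq (hG : G.Connected) (g : G ≃g G) (x y : V) :
    G.dist (g x) (g y) = G.dist x y := by
  have key : ∀ (f : G ≃g G) (x y : V), G.dist (f x) (f y) ≤ G.dist x y := by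
    intro f x y
    obtain ⟨p, hp⟩ := hG.exists_walk_length_eq_dist x y
    rw [← hp, ← p.length_map f.toHom]
    exact dist_le _
  refine le_antisymm (key g x y) ?_
  simpa using key g.symm (g x) (g y)

lemma IsTree.eq_of_adj_of_dist_eq (hG : G.IsTree) {u x y z : V} (hy : G.Adj x y) (hz : G.Adj x z)
    (hdy : G.dist u x = G.dist u y + 1) (hdz : G.dist u x = G.dist u z + 1) : y = z := by
  obtain ⟨p, hp⟩ := hG.connected.exists_walk_length_eq_dist u y
  obtain ⟨q, hq⟩ := hG.connected.exists_walk_length_eq_dist u z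
  have hp' : (p.concat hy.symm).IsPath :=
    Walk.isPath_of_length_eq_dist _ (by rw [Walk.length_concat]; omega)
  have hq' : (q.concat hz.symm).IsPath :=
    Walk.isPath_of_length_eq_dist _ (by rw [Walk.length_concat]; omega)
  have := hG.isAcyclic.subsingleton_path u x
  have h := congrArg Subtype.val (Subsingleton.elim (⟨_, hp'⟩ : G.Path u x) ⟨_, hq'⟩)
  have h' := congrArg Walk.penultimate h
  simpa using h'

lemma Connected.exists_adj_dist_eq (hG : G.Connected) {u x : V} {k : ℕ}
    (hx : G.dist u x = k + 1) : ∃ z, G.Adj x z ∧ G.dist u z = k := by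
  obtain ⟨p, hp⟩ := hG.exists_walk_length_eq_dist x u
  rw [dist_comm, hx] at hp
  cases p with
  | nil => simp at hp
  | @cons _ z _ h q =>
    refine ⟨z, h, ?_⟩
    have h1 := dist_le q
    have h2 := hG.dist_triangle (u := u) (v := z) (w := x)
    rw [dist_eq_one_iff_adj.2 h.symm] at h2
    rw [dist_comm] at h1
    simp at hp
    omega

/-- Two edges of a tree that are related by distance coincide. -/
lemma IsTree.eq_of_dist_lt_of_dist_lt (hG : G.IsTree) {u v x y : V} (huv : G.Adj u v)
    (hxy : G.Adj x y) (hu : G.dist u x < G.dist u y) (hv : G.dist v y < G.dist v x) : x = u := by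
  by_contra hne
  have h1 := hG.dist_eq_dist_add_one_of_adj u hxy
  have h2 := hG.dist_eq_dist_add_one_of_adj v hxy
  have h3 := hG.dist_eq_dist_add_one_of_adj x huv
  have h4 := hG.dist_eq_dist_add_one_of_adj y huv
  rw [dist_comm (u := x), dist_comm (u := x)] at h3
  rw [dist_comm (u := y), dist_comm (u := y)] at h4
  have hpos := hG.connected.pos_dist_of_ne (Ne.symm hne)
  obtain ⟨k, hk⟩ : ∃ k, G.dist u x = k + 1 := ⟨G.dist u x - 1, by omega⟩
  obtain ⟨z, hxz, hz⟩ := hG.connected.exists_adj_dist_eq hk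
  have h5 := hG.dist_eq_dist_add_one_of_adj z huv
  rw [dist_comm (u := z), dist_comm (u := z)] at h5
  have h6 := hG.dist_eq_dist_add_one_of_adj v hxz
  have : z = y := hG.eq_of_adj_of_dist_eq (u := v) hxz hxy (by omega) (by omega)
  subst this
  omega

lemma IsTree.exists_adj_dist_eq_add_one (hG : G.IsTree) (r : V) {x a b : V} (hab : a ≠ b)
    (ha : G.Adj x a) (hb : G.Adj x b) : ∃ y, G.Adj x y ∧ G.dist r y = G.dist r x + 1 := by
  by_contra! h
  exact hab (hG.eq_of_adj_of_dist_eq ha hb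
    ((hG.dist_eq_dist_add_one_of_adj r ha).resolve_right (h a ha))
    ((hG.dist_eq_dist_add_one_of_adj r hb).resolve_right (h b hb)))

section ChildMap

variable {r : V} {c : V → V}

lemma dist_iterate_eq (hdist : ∀ x, G.dist r (c x) = G.dist r x + 1) (x : V) (k : ℕ) :
    G.dist r (c^[k] x) = G.dist r x + k := by
  induction k with
  | zero => rfl
  | succ k ih => rw [Function.iterate_succ_apply', hdist, ih]; rfl

lemma IsTree.injective_of_dist_eq_add_one (hG : G.IsTree) (hadj : ∀ x, G.Adj x (c x))
    (hdist : ∀ x, G.dist r (c x) = G.dist r x + 1) : Function.Injective c := by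
  intro x y hxy
  have hy := (hadj y).symm
  have hy' := hdist y
  rw [← hxy] at hy hy'
  exact hG.eq_of_adj_of_dist_eq (hadj x).symm hy (hdist x) hy'

lemma iterate_eq_iterate_of_notMem_range (hc : Function.Injective c) {s s' : V} {k k' : ℕ}
    (hs : s ∉ Set.range c) (hs' : s' ∉ Set.range c) (h : c^[k] s = c^[k'] s') :
    s = s' ∧ k = k' := by
  induction k generalizing k' with
  | zero =>
    cases k' with
    | zero => exact ⟨h, rfl⟩
    | succ k' => exact absurd ⟨_, (h.trans (Function.iterate_succ_apply' c k' s')).symm⟩ hs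
  | succ k ih =>
    cases k' with
    | zero => exact absurd ⟨_, ((Function.iterate_succ_apply' c k s).symm.trans h)⟩ hs'
    | succ k' =>
      rw [Function.iterate_succ_apply', Function.iterate_succ_apply'] at h
      obtain ⟨h1, h2⟩ := ih (hc h)
      exact ⟨h1, by rw [h2]⟩

lemma IsTree.finite_dist_map_lt (hG : G.IsTree) (hadj : ∀ x, G.Adj x (c x))
    (hdist : ∀ x, G.dist r (c x) = G.dist r x + 1) (u : V) :
    {x | G.dist u (c x) < G.dist u x}.Finite := by
  obtain ⟨p⟩ := hG.connected u r
  induction p with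
  | nil => simp [hdist]
  | @cons u v w h p ih =>
    refine ((ih hdist).union (Set.finite_singleton v)).subset fun x hx => ?_
    by_cases hv : G.dist v (c x) < G.dist v x
    · exact Or.inl hv
    · have := hG.dist_ne_of_adj v (hadj x)
      exact Or.inr (hG.eq_of_dist_lt_of_dist_lt h.symm (hadj x) (by omega) hx)

lemma IsTree.dist_iterate_eq_of_dist_lt (hG : G.IsTree) (hadj : ∀ x, G.Adj x (c x))
    (hdist : ∀ x, G.dist r (c x) = G.dist r x + 1) {u x : V} (hx : G.dist u x < G.dist u (c x))
    (k : ℕ) : G.dist u (c^[k] x) = G.dist u x + k := by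
  induction k generalizing x with
  | zero => rfl
  | succ k ih =>
    have h1 := hG.dist_eq_dist_add_one_of_adj u (hadj x)
    have h2 := hG.dist_eq_dist_add_one_of_adj u (hadj (c x))
    have h3 : G.dist u (c x) < G.dist u (c (c x)) := by
      by_contra hlt
      have := hG.eq_of_adj_of_dist_eq (u := u) (hadj x).symm (hadj (c x)) (by omega) (by omega)
      have h4 := hdist x
      have h5 := hdist (c x)
      rw [← this] at h5
      omega
    rw [Function.iterate_succ_apply, ih h3]
    omega

end ChildMap

end SimpleGraph

section Density

variable {V : Type*} {G : SimpleGraph V}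

lemma gball_mono (u : V) {m n : ℕ} (h : m ≤ n) : gball G u m ⊆ gball G u n :=
  fun _ hx => le_trans hx h

/-- A bound on `W` in all balls by arbitrarily small fractions, up to additive constants, gives
density zero. -/
lemma densityZeroAt_of_mul_ncard_le {W : Set V} {u : V}
    (hball : ∀ n, n ≤ (gball G u n).ncard)
    (h : ∀ M : ℕ, ∃ K : ℕ, ∀ n,
      M * (gball G u n ∩ W).ncard ≤ K + (gball G u n).ncard) :
    DensityZeroAt G W u := by
  have htop : Tendsto (fun n => ((gball G u n).ncard : ℝ)) atTop atTop :=
    tendsto_natCast_atTop_atTop.comp (tendsto_atTop_mono hball tendsto_id)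
  rw [DensityZeroAt, Metric.tendsto_atTop']
  intro ε hε
  obtain ⟨M, hM⟩ := exists_nat_gt (2 / ε)
  have hMpos : (0 : ℝ) < M := lt_trans (by positivity) hM
  obtain ⟨K, hK⟩ := h M
  obtain ⟨N, hN⟩ := (htop.eventually_gt_atTop (K : ℝ)).exists_forall_of_atTop
  refine ⟨N, fun n hn => ?_⟩
  have h1 := hN n hn.le
  have hb : (0 : ℝ) < (gball G u n).ncard := lt_of_le_of_lt (Nat.cast_nonneg K) h1
  have h2 : (M : ℝ) * (gball G u n ∩ W).ncard ≤ K + (gball G u n).ncard := mod_cast hK n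
  rw [Real.dist_0_eq_abs, abs_of_nonneg (by positivity), div_lt_iff₀ hb]
  rw [div_lt_iff₀ hε] at hM
  refine lt_of_mul_lt_mul_left (a := (M : ℝ)) ?_ hMpos.le
  nlinarith

lemma densityZeroAt_of_infinite_gball {W : Set V} {u : V} {N : ℕ} (h : (gball G u N).Infinite) :
    DensityZeroAt G W u := by
  refine tendsto_const_nhds.congr' ?_
  filter_upwards [eventually_ge_atTop N] with n hn
  rw [(h.mono (gball_mono u hn)).ncard]
  simp

/-- A set that, up to finitely many points, picks one point on each of the rays into which an
injective choice of children partitions the tree, at heights tending to infinity, has density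
zero. -/
lemma SimpleGraph.IsTree.densityZeroAt_of_subset (hG : G.IsTree) {r : V} {c : V → V}
    (hadj : ∀ x, G.Adj x (c x)) (hdist : ∀ x, G.dist r (c x) = G.dist r x + 1)
    {t : V → ℕ} (ht : ∀ M, {s | t s < M}.Finite) {F W : Set V} (hF : F.Finite)
    (hW : W ⊆ F ∪ (fun s => c^[t s] s) '' (Set.range c)ᶜ) (u : V) : DensityZeroAt G W u := by
  by_cases hfin : ∀ n, (gball G u n).Finite
  swap
  · push Not at hfin
    obtain ⟨N, hN⟩ := hfin
    exact densityZeroAt_of_infinite_gball hN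
  have hc := hG.injective_of_dist_eq_add_one hadj hdist
  refine densityZeroAt_of_mul_ncard_le (fun n => ?_) fun M => ?_
  · have hsub : (fun k => c^[k] u) '' Set.Iio n ⊆ gball G u n := by
      rintro _ ⟨k, hk, rfl⟩
      have : ∀ k, G.dist u (c^[k] u) ≤ k := by
        intro k
        induction k with
        | zero => simp
        | succ k ih =>
          have := hG.dist_eq_dist_add_one_of_adj u (hadj (c^[k] u))
          rw [Function.iterate_succ_apply']
          omega
      exact (this k).trans (le_of_lt hk)
    have hinj : Set.InjOn (fun k => c^[k] u) (Set.Iio n) := by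
      intro k _ k' _ hkk
      have := congrArg (G.dist r) hkk
      simp only [dist_iterate_eq hdist] at this
      omega
    calc n = ((fun k => c^[k] u) '' Set.Iio n).ncard := by
          rw [hinj.ncard_image]; simp [Set.ncard_eq_toFinset_card']
      _ ≤ _ := Set.ncard_le_ncard hsub (hfin n)
  set w : V → V := fun s => c^[t s] s
  set A : Set V := {s | t s < M} ∪ {s | G.dist u (c s) < G.dist u s}
  have hA : A.Finite := (ht M).union (hG.finite_dist_map_lt hadj hdist u)
  have hFA : (F ∪ w '' A).Finite := hF.union (hA.image w)
  refine ⟨M * (F ∪ w '' A).ncard, fun n => ?_⟩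
  set S : Set V := {s | s ∉ Set.range c ∧ s ∉ A ∧ w s ∈ gball G u n}
  have hwinj : Set.InjOn w S := fun s hs s' hs' h =>
    (iterate_eq_iterate_of_notMem_range hc hs.1 hs'.1 h).1
  have hS : S.Finite := Set.Finite.of_injOn (fun s hs => hs.2.2) hwinj (hfin n)
  have hsub : gball G u n ∩ W ⊆ (F ∪ w '' A) ∪ w '' S := by
    rintro x ⟨hx, hxW⟩
    rcases hW hxW with hxF | ⟨s, hs, rfl⟩
    · exact Or.inl (Or.inl hxF)
    · by_cases hsA : s ∈ A
      · exact Or.inl (Or.inr ⟨s, hsA, rfl⟩)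
      · exact Or.inr ⟨s, ⟨hs, hsA, hx⟩, rfl⟩
  have hcard : (gball G u n ∩ W).ncard ≤ (F ∪ w '' A).ncard + S.ncard :=
    calc _ ≤ _ := Set.ncard_le_ncard hsub (hFA.union (hS.image w))
      _ ≤ _ := Set.ncard_union_le _ _
      _ ≤ _ := Nat.add_le_add_left (Set.ncard_image_le hS) _
  have hprod : (S ×ˢ Set.Iio M).ncard ≤ (gball G u n).ncard := by
    refine Set.ncard_le_ncard_of_injOn (fun q => c^[q.2] q.1) ?_ ?_ (hfin n)
    · rintro ⟨s, k⟩ ⟨⟨-, hsA, hsn⟩, hk⟩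
      simp only [A, Set.mem_union, Set.mem_ofPred_eq, not_or, not_lt] at hsA
      have hlt : G.dist u s < G.dist u (c s) :=
        lt_of_le_of_ne hsA.2 (hG.dist_ne_of_adj u (hadj s))
      have h1 := hG.dist_iterate_eq_of_dist_lt hadj hdist hlt k
      have h2 : G.dist u (c^[t s] s) ≤ n := hsn
      rw [hG.dist_iterate_eq_of_dist_lt hadj hdist hlt] at h2
      simp only [Set.mem_Iio] at hk
      change G.dist u (c^[k] s) ≤ n
      omega
    · rintro ⟨s, k⟩ ⟨hs, -⟩ ⟨s', k'⟩ ⟨hs', -⟩ h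
      obtain ⟨h1, h2⟩ := iterate_eq_iterate_of_notMem_range hc hs.1 hs'.1 h
      exact Prod.ext h1 h2
  rw [Set.ncard_prod] at hprod
  simp only [Set.ncard_eq_toFinset_card', Set.toFinset_Iio, Nat.card_Iio] at hprod
  nlinarith

end Density

section Distinguishing

variable {V : Type*} {G : SimpleGraph V}

/-- A color-preserving automorphism fixing the root is trivial if the red vertices have pairwise
different depths and every ray carries one. -/
lemma SimpleGraph.IsTree.apply_eq_self_of_apply_root (hG : G.IsTree) {r : V} {c : V → V}
    (hadj : ∀ x, G.Adj x (c x)) (hdist : ∀ x, G.dist r (c x) = G.dist r x + 1) {W : Set V}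
    (hW : Set.InjOn (G.dist r) W) (hray : ∀ s ∉ Set.range c, ∃ k, c^[k] s ∈ W)
    (g : G ≃g G) (hg : ∀ x ∈ W, g x ∈ W) (hr : g r = r) (x : V) : g x = x := by
  have hd : ∀ x, G.dist r (g x) = G.dist r x := fun x => by
    conv_lhs => rw [← hr]
    exact g.dist_map_eq hG.connected r x
  have hfix : ∀ x ∈ W, g x = x := fun x hx => hW (hg x hx) hx (hd x)
  have hback : ∀ k x, g (c^[k] x) = c^[k] x → g x = x := by
    intro k
    induction k with
    | zero => exact fun x h => h
    | succ k ih =>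
      intro x h
      have h1 : g (c x) = c x := ih _ h
      have h2 : G.Adj (c x) (g x) := by
        rw [← h1]
        exact g.map_adj_iff.2 (hadj x).symm
      exact hG.eq_of_adj_of_dist_eq (u := r) h2 (hadj x).symm (by rw [hd, hdist]) (hdist x)
  have hstart : ∀ s ∉ Set.range c, g s = s := fun s hs =>
    let ⟨k, hk⟩ := hray s hs
    hback k s (hfix _ hk)
  obtain ⟨n, hn⟩ : ∃ n, G.dist r x = n := ⟨_, rfl⟩
  induction n using Nat.strong_induction_on generalizing x with
  | _ n ih =>
    by_cases hx : x ∈ Set.range c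
    swap
    · exact hstart x hx
    obtain ⟨y, rfl⟩ := hx
    have hy : g y = y := ih _ (by rw [← hn, hdist]; omega) y rfl
    by_cases hgx : g (c y) ∈ Set.range c
    · obtain ⟨z, hz⟩ := hgx
      have h1 : G.Adj (g (c y)) y := by
        conv_rhs => rw [← hy]
        exact g.map_adj_iff.2 (hadj y).symm
      have h2 : G.Adj (g (c y)) z := by rw [← hz]; exact (hadj z).symm
      have : y = z := hG.eq_of_adj_of_dist_eq (u := r) h1 h2 (by rw [hd, hdist])
        (by rw [← hz, hdist])
      rw [← hz, this]
    · exact g.injective (hstart _ hgx)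

/-- A color-preserving automorphism fixes the root `r` if `r` and its child on the chosen ray are
the only adjacent red vertices, and the red third descendant on that ray breaks the remaining
symmetry. -/
lemma SimpleGraph.IsTree.apply_root_eq (hG : G.IsTree) {r : V} {c : V → V}
    (hadj : ∀ x, G.Adj x (c x)) (hdist : ∀ x, G.dist r (c x) = G.dist r x + 1) {W : Set V}
    (hr : r ∈ W) (hcr : c r ∈ W) (hcr3 : c (c (c r)) ∈ W)
    (htwo : ∀ x ∈ W, G.dist r x ≠ 2)
    (hconsec : ∀ x ∈ W, G.dist r x ≠ 0 → ∀ y ∈ W, G.dist r y ≠ G.dist r x + 1)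
    (g : G ≃g G) (hg : ∀ x ∈ W, g x ∈ W) : g r = r := by
  have h1 : G.Adj (g r) (g (c r)) := g.map_adj_iff.2 (hadj r)
  have h0 : G.dist r r = 0 := dist_self
  have hd1 := hdist r
  rcases hG.dist_eq_dist_add_one_of_adj r h1 with h | h
  · have hz : G.dist r (g (c r)) = 0 := by
      by_contra hne
      exact hconsec _ (hg _ hcr) hne _ (hg _ hr) h
    have hgc : g (c r) = r := ((hG.connected.dist_eq_zero_iff).1 hz).symm
    have h2 : G.dist (g (c r)) (g (c (c (c r)))) = G.dist (c r) (c (c (c r))) :=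
      g.dist_map_eq hG.connected _ _
    have h3 : G.dist (c r) (c (c (c r))) = 2 :=
      hG.dist_iterate_eq_of_dist_lt hadj hdist (u := c r) (x := c r)
        (by rw [dist_self]; exact hG.connected.pos_dist_of_ne (hadj _).ne) 2 |>.trans (by simp)
    rw [hgc, h3] at h2
    exact absurd h2 (htwo _ (hg _ hcr3))
  · have hz : G.dist r (g r) = 0 := by
      by_contra hne
      exact hconsec _ (hg _ hr) hne _ (hg _ hcr) h
    exact ((hG.connected.dist_eq_zero_iff).1 hz).symm

end Distinguishing

/-- Every countably infinite tree in which every vertex has degree at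
least 2 (a denumerable tree without leaves) is 2-distinguishable with density zero. -/
theorem stmt_4 {V : Type*} [Countable V] [Infinite V] (G : SimpleGraph V)
    (htree : G.IsTree)
    (hdeg : ∀ v : V, ∃ a b : V, a ≠ b ∧ G.Adj v a ∧ G.Adj v b) :
    ∃ l : V → Bool, Distinguishing G l ∧
      ∃ b : Bool, ∀ u : V, DensityZeroAt G {x | l x = b} u := by
  classical
  obtain ⟨r⟩ : Nonempty V := inferInstance
  obtain ⟨e, he⟩ := exists_injective_nat V
  have hchild : ∀ x, ∃ y, G.Adj x y ∧ G.dist r y = G.dist r x + 1 := fun x =>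
    let ⟨_, _, hab, ha, hb⟩ := hdeg x
    htree.exists_adj_dist_eq_add_one r hab ha hb
  choose c hadj hdist using hchild
  set D : V → ℕ := fun s => 10 + 4 * Nat.pair (G.dist r s) (e s) with hD
  set t : V → ℕ := fun s => D s - G.dist r s with htdef
  have hpair : ∀ s, G.dist r s + e s ≤ Nat.pair (G.dist r s) (e s) := fun s => Nat.add_le_pair _ _
  have het : ∀ s, e s ≤ t s := fun s => by have := hpair s; simp only [htdef, hD]; omega
  have hdepth : ∀ s, G.dist r (c^[t s] s) = D s := fun s => by
    have := hpair s
    rw [dist_iterate_eq hdist]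
    simp only [htdef, hD]
    omega
  have hDinj : ∀ s s', D s = D s' → s = s' := fun s s' h => by
    have : Nat.pair (G.dist r s) (e s) = Nat.pair (G.dist r s') (e s') := by
      simp only [hD] at h
      omega
    exact he (Nat.pair_eq_pair.1 this).2
  set F : Set V := {r, c r, c (c (c r))} with hF
  set W : Set V := F ∪ (fun s => c^[t s] s) '' (Set.range c)ᶜ
  have h0 : G.dist r r = 0 := dist_self
  have hdW : ∀ x ∈ W, (x = r ∧ G.dist r x = 0) ∨ (x = c r ∧ G.dist r x = 1) ∨
      (x = c (c (c r)) ∧ G.dist r x = 3) ∨ ∃ s, x = c^[t s] s ∧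
        G.dist r x = D s ∧ 10 ≤ D s ∧ D s % 4 = 2 := by
    rintro x ((rfl | rfl | rfl) | ⟨s, -, rfl⟩)
    · simp
    · simp [hdist]
    · simp [hdist]
    · exact Or.inr (Or.inr (Or.inr ⟨s, rfl, hdepth s, by simp only [hD]; omega⟩))
  have hWinj : Set.InjOn (G.dist r) W := by
    intro x hx y hy hxy
    rcases hdW x hx with ⟨h, h'⟩ | ⟨h, h'⟩ | ⟨h, h'⟩ | ⟨s, h, h'⟩ <;>
      rcases hdW y hy with ⟨k, k'⟩ | ⟨k, k'⟩ | ⟨k, k'⟩ | ⟨s', k, k'⟩ <;>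
      first
      | exact h.trans k.symm
      | (rw [h, k, hDinj s s' (by omega)])
      | (exfalso; omega)
  have htwo : ∀ x ∈ W, G.dist r x ≠ 2 := by
    intro x hx
    rcases hdW x hx with ⟨h, h'⟩ | ⟨h, h'⟩ | ⟨h, h'⟩ | ⟨s, h, h'⟩ <;> omega
  have hconsec : ∀ x ∈ W, G.dist r x ≠ 0 → ∀ y ∈ W, G.dist r y ≠ G.dist r x + 1 := by
    intro x hx hx0 y hy
    rcases hdW x hx with ⟨h, h'⟩ | ⟨h, h'⟩ | ⟨h, h'⟩ | ⟨s, h, h'⟩ <;>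
      rcases hdW y hy with ⟨k, k'⟩ | ⟨k, k'⟩ | ⟨k, k'⟩ | ⟨s', k, k'⟩ <;>
      omega
  have hlW : ∀ x, decide (x ∈ W) = true ↔ x ∈ W := fun x => decide_eq_true_iff
  refine ⟨fun x => decide (x ∈ W), fun g hg => ?_, true, fun u => ?_⟩
  · have hgW : ∀ x ∈ W, g x ∈ W := fun x hx => by
      have : decide (g x ∈ W) = decide (x ∈ W) := hg x
      rwa [(hlW x).2 hx, hlW] at this
    refine htree.apply_eq_self_of_apply_root hadj hdist hWinj
      (fun s hs => ⟨t s, Or.inr ⟨s, hs, rfl⟩⟩) g hgW ?_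
    exact htree.apply_root_eq hadj hdist (Or.inl (by simp [hF])) (Or.inl (by simp [hF]))
      (Or.inl (by simp [hF])) htwo hconsec g hgW
  · refine htree.densityZeroAt_of_subset hadj hdist (t := t) (F := F) (fun M => ?_) ?_ ?_ u
    · exact ((Set.finite_Iio M).preimage he.injOn).subset fun s hs => lt_of_le_of_lt (het s) hs
    · simp [hF]
    · exact fun x hx => (hlW x).1 hx
end

section
/- Every countably infinite, vertex-transitive graph of connectivity 1 (i.e., connected and possessing a cutvertex) is 2-distinguishable with density zero, i.e., it admits a distinguishing 2-coloring one of whose color classes W satisfies δ_v(W) = 0 for every vertex v. -/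
open Filter SimpleGraph

namespace SimpleGraph

variable {V : Type*} {G : SimpleGraph V}

/-- Every walk from `o` to `z` passes through `x`. -/
def WalkSeparates (G : SimpleGraph V) (o x z : V) : Prop :=
  ∀ p : G.Walk o z, x ∈ p.support

theorem WalkSeparates.left (G : SimpleGraph V) (o z : V) : G.WalkSeparates o o z :=
  fun p => p.start_mem_support

theorem WalkSeparates.trans {o x y z : V} (hxy : G.WalkSeparates o x y)
    (hyz : G.WalkSeparates o y z) : G.WalkSeparates o x z := by
  classical
  intro p
  exact p.support_takeUntil_subset_support (hyz p) (hxy (p.takeUntil y (hyz p)))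

theorem WalkSeparates.map_iso {o x z : V} (h : G.WalkSeparates o x z) (g : G ≃g G) :
    G.WalkSeparates (g o) (g x) (g z) := by
  intro p
  have hx := h ((p.map g.symm.toHom).copy (g.symm_apply_apply o) (g.symm_apply_apply z))
  rw [Walk.support_copy, Walk.support_map, List.mem_map] at hx
  obtain ⟨y, hy, hyx⟩ := hx
  have hyx' : g.symm y = x := hyx
  rwa [← hyx', g.apply_symm_apply]

theorem Walk.dist_add_dist_le_length {a b y : V} (p : G.Walk a b) (hy : y ∈ p.support) :
    G.dist a y + G.dist y b ≤ p.length := by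
  classical
  have h := congrArg Walk.length (p.take_spec hy)
  rw [Walk.length_append] at h
  have h₁ := dist_le (p.takeUntil y hy)
  have h₂ := dist_le (p.dropUntil y hy)
  lia

theorem WalkSeparates.dist_add {o x z : V} (h : G.WalkSeparates o x z) (hG : G.Connected) :
    G.dist o x + G.dist x z = G.dist o z := by
  obtain ⟨p, hp⟩ := hG.exists_walk_length_eq_dist o z
  exact le_antisymm (hp ▸ p.dist_add_dist_le_length (h p)) hG.dist_triangle

theorem WalkSeparates.eq_of_dist_eq {o x y z : V} (hx : G.WalkSeparates o x z)
    (hy : G.WalkSeparates o y z) (hG : G.Connected) (h : G.dist o x = G.dist o y) : x = y := by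
  obtain ⟨p, hp⟩ := hG.exists_walk_length_eq_dist o x
  obtain ⟨q, hq⟩ := hG.exists_walk_length_eq_dist x z
  have hxz := hx.dist_add hG
  have hyz := hy.dist_add hG
  rcases (Walk.mem_support_append_iff p q).1 (hy (p.append q)) with hm | hm
  · have := p.dist_add_dist_le_length hm
    exact (hG.dist_eq_zero_iff.1 (by lia : G.dist y x = 0)).symm
  · have := q.dist_add_dist_le_length hm
    exact hG.dist_eq_zero_iff.1 (by lia : G.dist x y = 0)

theorem Iso.dist_apply (g : G ≃g G) (hG : G.Connected) (u v : V) :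
    G.dist (g u) (g v) = G.dist u v := by
  have key : ∀ (f : G ≃g G) (a b : V), G.dist (f a) (f b) ≤ G.dist a b := by
    intro f a b
    obtain ⟨p, hp⟩ := hG.exists_walk_length_eq_dist a b
    have h := dist_le (p.map f.toHom)
    rw [Walk.length_map, hp] at h
    exact h
  refine le_antisymm (key g u v) ?_
  simpa using key g.symm (g u) (g v)

theorem exists_walkSeparates_of_not_connected_induce [Nontrivial V] {v : V}
    (h : ¬ (G.induce ({v}ᶜ : Set V)).Connected) :
    ∃ a b : V, a ≠ v ∧ b ≠ v ∧ G.WalkSeparates a v b := by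
  by_contra! hc
  apply h
  obtain ⟨w, hw⟩ := exists_ne v
  have : Nonempty ({v}ᶜ : Set V) := ⟨⟨w, hw⟩⟩
  refine ⟨fun a b => ?_⟩
  have hab := hc a b a.2 b.2
  simp only [WalkSeparates, not_forall] at hab
  obtain ⟨p, hp⟩ := hab
  exact ⟨p.induce ({v}ᶜ : Set V) fun x hx hxv => hp (hxv ▸ hx)⟩

theorem exists_ne_walkSeparates [Nontrivial V] (htrans : ∀ u v : V, ∃ g : G ≃g G, g u = v)
    (hcut : ∃ v : V, ¬ (G.induce ({v}ᶜ : Set V)).Connected) (o x : V) :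
    ∃ c, c ≠ x ∧ G.WalkSeparates o x c := by
  obtain ⟨v, hv⟩ := hcut
  obtain ⟨a, b, ha, hb, hab⟩ := exists_walkSeparates_of_not_connected_induce hv
  obtain ⟨g, rfl⟩ := htrans v x
  have hg := hab.map_iso g
  by_contra! hc
  have hac := hc (g a) (g.injective.ne ha)
  have hbc := hc (g b) (g.injective.ne hb)
  simp only [WalkSeparates, not_forall] at hac hbc
  obtain ⟨p, hp⟩ := hac
  obtain ⟨q, hq⟩ := hbc
  rcases (Walk.mem_support_append_iff p.reverse q).1 (hg (p.reverse.append q)) with h | h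
  · exact hp (by simpa using h)
  · exact hq h

/-- In a connected vertex-transitive graph with a cutvertex, vertices arbitrarily far from `o`
hang behind any given vertex `x`. -/
theorem exists_walkSeparates_lt_dist [Nontrivial V] (hG : G.Connected)
    (htrans : ∀ u v : V, ∃ g : G ≃g G, g u = v)
    (hcut : ∃ v : V, ¬ (G.induce ({v}ᶜ : Set V)).Connected) (o x : V) (N : ℕ) :
    ∃ z, G.WalkSeparates o x z ∧ N < G.dist o z := by
  have step : ∀ N : ℕ, ∃ z, G.WalkSeparates o x z ∧ N ≤ G.dist o z := by
    intro N
    induction N with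
    | zero => exact ⟨x, fun p => p.end_mem_support, Nat.zero_le _⟩
    | succ N ih =>
      obtain ⟨y, hy, hN⟩ := ih
      obtain ⟨c, hc, hyc⟩ := exists_ne_walkSeparates htrans hcut o y
      refine ⟨c, hy.trans hyc, ?_⟩
      have := hyc.dist_add hG
      have := hG.pos_dist_of_ne hc.symm
      lia
  exact step (N + 1)

/-- A sequence of vertices starting at `o` whose distances to `o` more than double at every step,
such that `w 1` separates `o` from `w 2` and every vertex separates `o` from some term. -/
structure SparseMarking (G : SimpleGraph V) (o : V) (w : ℕ → V) : Prop where
  zero : w 0 = o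
  lt_succ : ∀ n, 2 * G.dist o (w n) < G.dist o (w (n + 1))
  one_two : G.WalkSeparates o (w 1) (w 2)
  exists_separates : ∀ x, ∃ n, G.WalkSeparates o x (w n)

theorem exists_sparseMarking [Countable V] [Nontrivial V] (hG : G.Connected)
    (htrans : ∀ u v : V, ∃ g : G ≃g G, g u = v)
    (hcut : ∃ v : V, ¬ (G.induce ({v}ᶜ : Set V)).Connected) (o : V) :
    ∃ w, SparseMarking G o w := by
  have : Nonempty V := ⟨o⟩
  obtain ⟨e, he⟩ := exists_surjective_nat V
  choose f hf hfd using exists_walkSeparates_lt_dist hG htrans hcut o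
  let p := f o 0
  let x : ℕ → V := fun n => Nat.casesOn n p e
  let w : ℕ → V := fun n => Nat.rec p (fun k y => f (x k) (2 * G.dist o y)) n
  refine ⟨fun n => Nat.casesOn n o w, rfl, ?_, hf p _, fun y => ?_⟩
  · rintro (_ | n)
    · have h : 0 < G.dist o p := hfd o 0
      simpa [w] using h
    · exact hfd _ _
  · obtain ⟨n, rfl⟩ := he y
    exact ⟨n + 3, hf (e n) _⟩

namespace SparseMarking

variable {o : V} {w : ℕ → V}

theorem dist_zero (hw : SparseMarking G o w) : G.dist o (w 0) = 0 := by
  rw [hw.zero, dist_self]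

theorem strictMono (hw : SparseMarking G o w) : StrictMono fun n => G.dist o (w n) :=
  strictMono_nat_of_lt_succ fun n => by have := hw.lt_succ n; lia

theorem two_mul_lt (hw : SparseMarking G o w) {i j : ℕ} (h : i < j) :
    2 * G.dist o (w i) < G.dist o (w j) :=
  (hw.lt_succ i).trans_le (hw.strictMono.monotone h)

theorem two_pow_le (hw : SparseMarking G o w) (n : ℕ) : 2 ^ n ≤ G.dist o (w n) + 1 := by
  induction n with
  | zero => simp
  | succ n ih =>
    have := hw.lt_succ n
    rw [pow_succ]
    lia

/-- The only pair of marked vertices at the smallest distance is `w 0`, `w 1`. -/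
theorem eq_zero_and_eq_one_of_dist_eq (hw : SparseMarking G o w) (hG : G.Connected) {a b : ℕ}
    (h : G.dist (w a) (w b) = G.dist o (w 1)) (hab : a < b) : a = 0 ∧ b = 1 := by
  by_contra hne
  have htri : G.dist o (w b) ≤ G.dist o (w a) + G.dist (w a) (w b) := hG.dist_triangle
  have h₁ : G.dist o (w 1) < G.dist o (w b) ∨ b = 1 := by
    rcases (show b = 1 ∨ 1 < b by lia) with hb | hb
    · exact Or.inr hb
    · exact Or.inl (hw.strictMono hb)
  rcases Nat.eq_zero_or_pos a with rfl | ha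
  · have := hw.dist_zero
    lia
  · have h₂ := hw.two_mul_lt hab
    have h₃ : G.dist o (w 1) ≤ G.dist o (w a) := hw.strictMono.monotone ha
    lia

theorem map_root (hw : SparseMarking G o w) (hG : G.Connected) (g : G ≃g G)
    (hg : ∀ n, ∃ m, g (w n) = w m) : g o = o := by
  obtain ⟨a, ha⟩ := hg 0
  obtain ⟨b, hb⟩ := hg 1
  obtain ⟨c, hc⟩ := hg 2
  have h01 : G.dist (w a) (w b) = G.dist o (w 1) := by
    rw [← ha, ← hb, g.dist_apply hG, hw.zero]
  have h1pos := hw.strictMono Nat.zero_lt_one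
  rcases lt_trichotomy a b with hab | rfl | hab
  · obtain ⟨rfl, rfl⟩ := hw.eq_zero_and_eq_one_of_dist_eq hG h01 hab
    rwa [hw.zero] at ha
  · simp only [dist_self] at h01
    lia
  · obtain ⟨rfl, rfl⟩ := hw.eq_zero_and_eq_one_of_dist_eq hG (dist_comm.trans h01) hab
    have hcd : G.dist o (w c) = G.dist (w 1) (w 2) := by
      rw [← hw.zero, ← hb, ← hc, g.dist_apply hG]
    have hsep := hw.one_two.dist_add hG
    have h12 := hw.two_mul_lt Nat.one_lt_two
    have hc1 : 1 < c := hw.strictMono.lt_iff_lt.1 (by lia : G.dist o (w 1) < G.dist o (w c))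
    have hc2 : c < 2 := hw.strictMono.lt_iff_lt.1 (by
      have : 0 < G.dist o (w 1) := (Nat.zero_le _).trans_lt h1pos
      lia : G.dist o (w c) < G.dist o (w 2))
    lia

theorem map_eq (hw : SparseMarking G o w) (hG : G.Connected) (g : G ≃g G)
    (hg : ∀ n, ∃ m, g (w n) = w m) (x : V) : g x = x := by
  have ho := hw.map_root hG g hg
  have hdist : ∀ y, G.dist o (g y) = G.dist o y := fun y => by
    conv_lhs => rw [← ho]
    exact g.dist_apply hG o y
  obtain ⟨n, hn⟩ := hw.exists_separates x
  obtain ⟨m, hm⟩ := hg n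
  have hmn : m = n := hw.strictMono.injective (by simpa [hm] using hdist (w n))
  have hgn := hn.map_iso g
  rw [ho, hm, hmn] at hgn
  exact hgn.eq_of_dist_eq hn hG (hdist x)

theorem ncard_gball_inter_le (hw : SparseMarking G o w) (hG : G.Connected) (u : V) (n : ℕ) :
    (gball G u n ∩ Set.range w).ncard ≤ Nat.log 2 (n + (G.dist o u + 1)) + 1 := by
  classical
  set m := n + (G.dist o u + 1)
  have hsub : gball G u n ∩ Set.range w ⊆
      ((Finset.range (Nat.log 2 m + 1)).image w : Finset V) := by
    rintro _ ⟨hx, i, rfl⟩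
    have hx' : G.dist u (w i) ≤ n := hx
    have htri : G.dist o (w i) ≤ G.dist o u + G.dist u (w i) := hG.dist_triangle
    have hpow := hw.two_pow_le i
    have hi : i ≤ Nat.log 2 m := Nat.le_log_of_pow_le Nat.one_lt_two (by lia)
    exact Finset.mem_coe.2 (Finset.mem_image_of_mem w (Finset.mem_range.2 (by lia)))
  refine (Set.ncard_le_ncard hsub (Finset.finite_toSet _)).trans ?_
  rw [Set.ncard_coe_finset]
  exact Finset.card_image_le.trans (Finset.card_range _).le

end SparseMarking

theorem Connected.exists_dist_eq (hG : G.Connected) {u z : V} {k : ℕ} (hk : k ≤ G.dist u z) :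
    ∃ y, G.dist u y = k := by
  obtain ⟨p, hp⟩ := hG.exists_walk_length_eq_dist u z
  refine ⟨p.getVert k, ?_⟩
  have h₁ := dist_le (p.take k)
  have h₂ := dist_le (p.drop k)
  have h₃ : G.dist u z ≤ G.dist u (p.getVert k) + G.dist (p.getVert k) z := hG.dist_triangle
  rw [Walk.take_length] at h₁
  rw [Walk.drop_length] at h₂
  lia

theorem Connected.lt_ncard_gball (hG : G.Connected) {u : V}
    (hunb : ∀ N, ∃ z, N < G.dist u z) {n : ℕ} (hfin : (gball G u n).Finite) :
    n < (gball G u n).ncard := by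
  classical
  have hex : ∀ k, ∃ y, G.dist u y = k := fun k => by
    obtain ⟨z, hz⟩ := hunb k
    exact hG.exists_dist_eq hz.le
  choose f hf using hex
  have hinj : Function.Injective f := fun a b h => by rw [← hf a, h, hf]
  have hsub : (((Finset.range (n + 1)).image f : Finset V) : Set V) ⊆ gball G u n := by
    intro y hy
    obtain ⟨k, hk, rfl⟩ := Finset.mem_image.1 (Finset.mem_coe.1 hy)
    have := Finset.mem_range.1 hk
    change G.dist u (f k) ≤ n
    rw [hf]
    lia
  have h := Set.ncard_le_ncard hsub hfin
  rwa [Set.ncard_coe_finset, Finset.card_image_of_injective _ hinj, Finset.card_range] at h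

end SimpleGraph

theorem tendsto_natLog_add_div_add_one (D : ℕ) :
    Tendsto (fun n : ℕ => ((Nat.log 2 (n + (D + 1)) + 1 : ℕ) : ℝ) / ((n + 1 : ℕ) : ℝ))
      atTop (nhds 0) := by
  have hcast : Tendsto (fun n : ℕ => ((n + (D + 1) : ℕ) : ℝ)) atTop atTop :=
    tendsto_natCast_atTop_atTop.comp (tendsto_add_atTop_nat (D + 1))
  have hlog : Tendsto (fun n : ℕ => Real.log ((n + (D + 1) : ℕ) : ℝ) / ((n + (D + 1) : ℕ) : ℝ))
      atTop (nhds 0) :=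
    Real.isLittleO_log_id_atTop.tendsto_div_nhds_zero.comp hcast
  have hlim : Tendsto (fun n : ℕ => (D + 1 : ℝ) *
      (Real.log ((n + (D + 1) : ℕ) : ℝ) / ((n + (D + 1) : ℕ) : ℝ) / Real.log 2 +
        ((n + (D + 1) : ℕ) : ℝ)⁻¹)) atTop (nhds 0) := by
    simpa using ((hlog.div_const (Real.log 2)).add
      (tendsto_inv_atTop_zero.comp hcast)).const_mul (D + 1 : ℝ)
  refine squeeze_zero (fun n => by positivity) (fun n => ?_) hlim
  have hm : (0 : ℝ) < ((n + (D + 1) : ℕ) : ℝ) := by positivity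
  have hb : ((Nat.log 2 (n + (D + 1)) : ℕ) : ℝ) ≤
      Real.log ((n + (D + 1) : ℕ) : ℝ) / Real.log 2 := by
    simpa [Real.logb] using Real.natLog_le_logb (n + (D + 1)) 2
  have hmn : ((n + (D + 1) : ℕ) : ℝ) ≤ (D + 1 : ℝ) * ((n + 1 : ℕ) : ℝ) := by
    push_cast
    nlinarith [mul_nonneg (Nat.cast_nonneg (α := ℝ) D) (Nat.cast_nonneg (α := ℝ) n)]
  have hL : (0 : ℝ) ≤ Real.log ((n + (D + 1) : ℕ) : ℝ) / Real.log 2 + 1 :=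
    le_trans (by positivity) (add_le_add_left hb 1)
  calc ((Nat.log 2 (n + (D + 1)) + 1 : ℕ) : ℝ) / ((n + 1 : ℕ) : ℝ)
      ≤ (Real.log ((n + (D + 1) : ℕ) : ℝ) / Real.log 2 + 1) / ((n + 1 : ℕ) : ℝ) := by
        gcongr
        push_cast at hb ⊢
        linarith
    _ ≤ (Real.log ((n + (D + 1) : ℕ) : ℝ) / Real.log 2 + 1) *
          ((D + 1 : ℝ) / ((n + (D + 1) : ℕ) : ℝ)) := by
        rw [div_eq_mul_inv]
        refine mul_le_mul_of_nonneg_left ?_ hL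
        rw [le_div_iff₀ hm, inv_mul_le_iff₀ (by positivity), mul_comm]
        exact hmn
    _ = _ := by ring

theorem SimpleGraph.SparseMarking.densityZeroAt {V : Type*} {G : SimpleGraph V} {o : V} {w : ℕ → V}
    (hw : SparseMarking G o w) (hG : G.Connected) {u : V} (hunb : ∀ N, ∃ z, N < G.dist u z) :
    DensityZeroAt G (Set.range w) u := by
  refine squeeze_zero (fun n => by positivity) (fun n => ?_)
    (tendsto_natLog_add_div_add_one (G.dist o u))
  rcases (gball G u n).finite_or_infinite with hfin | hinf
  · have h₁ := hw.ncard_gball_inter_le hG u n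
    have h₂ := hG.lt_ncard_gball hunb hfin
    gcongr
    exact h₂
  · rw [hinf.ncard, Nat.cast_zero, div_zero]
    positivity

/-- Every countably infinite, vertex-transitive, connected graph with a
cutvertex (i.e. of connectivity 1) is 2-distinguishable with density zero. -/
theorem stmt_5 {V : Type*} [Countable V] [Infinite V] (G : SimpleGraph V)
    (hconn : G.Connected)
    (htrans : ∀ u v : V, ∃ g : G ≃g G, g u = v)
    (hcut : ∃ v : V, ¬ (G.induce ({v}ᶜ : Set V)).Connected) :
    ∃ l : V → Bool, Distinguishing G l ∧
      ∃ b : Bool, ∀ u : V, DensityZeroAt G {x | l x = b} u := by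
  classical
  obtain ⟨o⟩ := hconn.nonempty
  obtain ⟨w, hw⟩ := exists_sparseMarking hconn htrans hcut o
  refine ⟨fun x => decide (x ∈ Set.range w), fun g hg x => ?_, true, fun u => ?_⟩
  · refine hw.map_eq hconn g (fun n => ?_) x
    have h : g (w n) ∈ Set.range w := (decide_eq_decide.1 (hg (w n))).2 ⟨n, rfl⟩
    obtain ⟨m, hm⟩ := h
    exact ⟨m, hm.symm⟩
  · have hset : {x | decide (x ∈ Set.range w) = true} = Set.range w := by
      ext x
      simp
    rw [hset]
    refine hw.densityZeroAt hconn fun N => ?_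
    obtain ⟨z, -, hz⟩ := exists_walkSeparates_lt_dist hconn htrans hcut u u N
    exact ⟨z, hz⟩
end

section
/- Let G be a connected, locally finite, infinite graph satisfying the Distinct Spheres Condition with respect to a vertex u. Then the orbit of u under the automorphism group of G contains only finitely many vertices w with w ~ u, where u ~ w iff B_u(n) = B_w(n) for some n ∈ ℕ. -/
open Filter SimpleGraph

theorem gball_succ {V : Type*} {G : SimpleGraph V} (hconn : G.Connected) (v : V) (n : ℕ) :
    gball G v (n + 1) = gball G v n ∪ ⋃ y ∈ gball G v n, G.neighborSet y := by
  ext x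
  simp only [gball, Set.mem_union, Set.mem_iUnion, Set.mem_ofPred_eq, exists_prop,
    SimpleGraph.mem_neighborSet]
  constructor
  · intro hx
    rcases Nat.lt_or_ge n (G.dist v x) with hlt | hle
    · right
      obtain ⟨p, hp⟩ := hconn.exists_walk_length_eq_dist x v
      rw [SimpleGraph.dist_comm] at hp
      cases p with
      | nil => simp at hlt
      | cons hadj q =>
        refine ⟨_, ?_, hadj.symm⟩
        have := SimpleGraph.dist_le q
        rw [SimpleGraph.dist_comm]
        simp only [SimpleGraph.Walk.length_cons] at hp
        omega
    · exact Or.inl hle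
  · rintro (hx | ⟨y, hy, hadj⟩)
    · omega
    · have := hconn.dist_triangle (u := v) (v := y) (w := x)
      rw [SimpleGraph.dist_eq_one_iff_adj.mpr hadj] at this
      omega

theorem finite_gball {V : Type*} {G : SimpleGraph V} (hconn : G.Connected)
    (hlf : ∀ x : V, (G.neighborSet x).Finite) (v : V) (n : ℕ) : (gball G v n).Finite := by
  induction n with
  | zero =>
    refine (Set.finite_singleton v).subset fun x hx => ?_
    exact (hconn.dist_eq_zero_iff.mp (Nat.le_zero.mp hx)).symm
  | succ n ih =>
    rw [gball_succ hconn]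
    exact ih.union (ih.biUnion fun y _ => hlf y)

theorem gball_eq_of_le {V : Type*} {G : SimpleGraph V} (hconn : G.Connected) {v w : V}
    {n m : ℕ} (h : gball G v n = gball G w n) (hnm : n ≤ m) : gball G v m = gball G w m := by
  induction m, hnm using Nat.le_induction with
  | base => exact h
  | succ m _ ih => rw [gball_succ hconn, gball_succ hconn, ih]

theorem gsphere_succ {V : Type*} (G : SimpleGraph V) (v : V) (n : ℕ) :
    gsphere G v (n + 1) = gball G v (n + 1) \ gball G v n := by
  ext x
  simp only [gsphere, gball, Set.mem_sdiff, Set.mem_ofPred_eq]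
  omega

theorem gsphere_eq_of_lt {V : Type*} {G : SimpleGraph V} (hconn : G.Connected) {v w : V}
    {n m : ℕ} (h : gball G v n = gball G w n) (hnm : n < m) : gsphere G v m = gsphere G w m := by
  obtain _ | m := m
  · omega
  · rw [gsphere_succ, gsphere_succ, gball_eq_of_le hconn h hnm.le,
      gball_eq_of_le hconn h (Nat.lt_succ_iff.mp hnm)]

theorem dist_map_iso_le {V : Type*} {G : SimpleGraph V} (hconn : G.Connected) (g : G ≃g G)
    (x y : V) : G.dist (g x) (g y) ≤ G.dist x y := by
  obtain ⟨p, hp⟩ := hconn.exists_walk_length_eq_dist x y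
  simpa [hp] using SimpleGraph.dist_le (p.map g.toHom)

theorem dist_map_iso {V : Type*} {G : SimpleGraph V} (hconn : G.Connected) (g : G ≃g G)
    (x y : V) : G.dist (g x) (g y) = G.dist x y :=
  (dist_map_iso_le hconn g x y).antisymm (by simpa using dist_map_iso_le hconn g.symm (g x) (g y))

theorem gball_map_iso {V : Type*} {G : SimpleGraph V} (hconn : G.Connected) (g : G ≃g G)
    (v : V) (n : ℕ) : gball G (g v) n = g.symm ⁻¹' gball G v n := by
  ext x
  simp only [gball, Set.mem_preimage, Set.mem_ofPred_eq]
  rw [← dist_map_iso hconn g v (g.symm x), RelIso.apply_symm_apply]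

/-- Under the Distinct Spheres Condition at `u`, the orbit of `u` lies in every ball around `u`
that is also a ball of the same radius around some other vertex. -/
theorem orbit_subset_gball {V : Type*} {G : SimpleGraph V} (hconn : G.Connected) {u w : V}
    (hdsc : ∀ x y : V, x ≠ y → G.dist u x = G.dist u y →
      {n : ℕ | gsphere G x n ≠ gsphere G y n}.Infinite)
    (hne : w ≠ u) {n : ℕ} (hn : gball G u n = gball G w n) (g : G ≃g G) :
    g u ∈ gball G u n := by
  by_contra hg
  have hlt : n < G.dist u (g u) := Nat.lt_of_not_le hg
  have hmem : g u ∈ gsphere G w (G.dist u (g u)) := gsphere_eq_of_lt hconn hn hlt ▸ rfl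
  have hdist : G.dist u (g.symm u) = G.dist u (g.symm w) := by
    rw [← dist_map_iso hconn g u (g.symm u), ← dist_map_iso hconn g u (g.symm w),
      RelIso.apply_symm_apply, RelIso.apply_symm_apply, SimpleGraph.dist_comm,
      SimpleGraph.dist_comm (u := g u)]
    exact hmem.symm
  have hball : gball G (g.symm u) n = gball G (g.symm w) n := by
    rw [gball_map_iso hconn, gball_map_iso hconn, hn]
  refine hdsc _ _ (fun h => hne (g.symm.injective h).symm) hdist
    ((Set.finite_Iic n).subset fun m hm => ?_)
  by_contra hlt'
  exact hm (gsphere_eq_of_lt hconn hball (Nat.lt_of_not_le hlt'))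

/-- Let `G` be a connected, locally finite, infinite graph satisfying
the Distinct Spheres Condition with respect to `u`. Then only finitely many vertices in
the orbit of `u` under the automorphism group are equivalent to `u`, where `u ~ w` iff
`B_u(n) = B_w(n)` for some `n`. -/
theorem stmt_12 {V : Type*} [Infinite V] (G : SimpleGraph V) (hconn : G.Connected)
    (hlf : ∀ x : V, (G.neighborSet x).Finite) (u : V)
    (hdsc : ∀ x y : V, x ≠ y → G.dist u x = G.dist u y →
      {n : ℕ | gsphere G x n ≠ gsphere G y n}.Infinite) :
    {w : V | (∃ g : G ≃g G, g u = w) ∧ ∃ n : ℕ, gball G u n = gball G w n}.Finite := by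
  by_cases h : ∃ w, w ≠ u ∧ ∃ n, gball G u n = gball G w n
  · obtain ⟨w, hne, n, hn⟩ := h
    refine (finite_gball hconn hlf u n).subset ?_
    rintro _ ⟨⟨g, rfl⟩, -⟩
    exact orbit_subset_gball hconn hdsc hne hn g
  · refine (Set.finite_singleton u).subset fun w hw => ?_
    by_contra hne
    exact h ⟨w, hne, hw.2⟩
end

section
/- Let G be a connected, locally finite graph with infinite motion and let g be an automorphism of G. Then every connected component of the graph obtained from G by removing the set Fix(g) of vertices fixed by g (together with all incident edges) is infinite. -/
open Filter SimpleGraph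

/-- A graph has infinite motion if every nontrivial automorphism moves infinitely many
vertices. -/
def InfiniteMotion {V : Type*} (G : SimpleGraph V) : Prop :=
  ∀ g : G ≃g G, (∃ x, g x ≠ x) → {x : V | g x ≠ x}.Infinite

/-- Two mutually inverse adjacency-preserving self-maps form an automorphism. -/
def isoOfInverseHoms {V : Type*} {G : SimpleGraph V} (f f' : V → V)
    (hl : ∀ x, f' (f x) = x) (hr : ∀ x, f (f' x) = x)
    (hf : ∀ x y, G.Adj x y → G.Adj (f x) (f y))
    (hf' : ∀ x y, G.Adj x y → G.Adj (f' x) (f' y)) : G ≃g G where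
  toFun := f
  invFun := f'
  left_inv := hl
  right_inv := hr
  map_rel_iff' := by
    intro x y
    refine ⟨fun h => ?_, hf x y⟩
    have := hf' _ _ h
    simpa only [Equiv.coe_fn_mk, hl] using this

/-- If `C` is invariant under `g` and every neighbor of `C` outside `C` is fixed by `g`, then
some automorphism agrees with `g` on `C` and is the identity elsewhere. -/
theorem exists_iso_eq_on_of_invariant {V : Type*} {G : SimpleGraph V} (g : G ≃g G) (C : Set V)
    (hC : ∀ x ∈ C, ∀ y, G.Adj x y → g y ≠ y → y ∈ C) (hinv : ∀ x, g x ∈ C ↔ x ∈ C) :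
    ∃ h : G ≃g G, (∀ x ∈ C, h x = g x) ∧ ∀ x ∉ C, h x = x := by
  classical
  have hinv' : ∀ x, g.symm x ∈ C ↔ x ∈ C := fun x => by
    rw [← hinv, RelIso.apply_symm_apply]
  have hfix : ∀ x ∈ C, ∀ y ∉ C, G.Adj x y → g y = y := fun x hx y hy hxy =>
    by_contra fun h => hy (hC x hx y hxy h)
  have hfix' : ∀ x ∈ C, ∀ y ∉ C, G.Adj x y → g.symm y = y := fun x hx y hy hxy =>
    g.symm_apply_eq.2 (hfix x hx y hy hxy).symm
  refine ⟨isoOfInverseHoms (fun x => if x ∈ C then g x else x)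
    (fun x => if x ∈ C then g.symm x else x) ?_ ?_ ?_ ?_, ?_, ?_⟩
  · intro x
    by_cases hx : x ∈ C <;> simp [hx, hinv]
  · intro x
    by_cases hx : x ∈ C <;> simp [hx, hinv']
  · intro x y hxy
    have hg : G.Adj (g x) (g y) := g.map_adj_iff.2 hxy
    by_cases hx : x ∈ C <;> by_cases hy : y ∈ C <;> simp only [hx, hy, if_true, if_false]
    · exact hg
    · rwa [hfix x hx y hy hxy] at hg
    · rwa [hfix y hy x hx hxy.symm] at hg
    · exact hxy
  · intro x y hxy
    have hg : G.Adj (g.symm x) (g.symm y) := g.symm.map_adj_iff.2 hxy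
    by_cases hx : x ∈ C <;> by_cases hy : y ∈ C <;> simp only [hx, hy, if_true, if_false]
    · exact hg
    · rwa [hfix' x hx y hy hxy] at hg
    · rwa [hfix' y hy x hx hxy.symm] at hg
    · exact hxy
  · intro x hx
    exact if_pos hx
  · intro x hx
    exact if_neg hx

/-- If `C` is disjoint from its image under `g` and every neighbor of `C` outside `C` is fixed
by `g`, then some automorphism swaps `C` with its image and is the identity elsewhere. -/
theorem exists_iso_swap_of_disjoint {V : Type*} {G : SimpleGraph V} (g : G ≃g G) (C : Set V)
    (hC : ∀ x ∈ C, ∀ y, G.Adj x y → g y ≠ y → y ∈ C) (hdis : ∀ x ∈ C, g x ∉ C) :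
    ∃ h : G ≃g G, (∀ x ∈ C, h x = g x) ∧ ∀ x, x ∉ C → g.symm x ∉ C → h x = x := by
  classical
  have hfix : ∀ x ∈ C, ∀ y ∉ C, G.Adj x y → g y = y := fun x hx y hy hxy =>
    by_contra fun h => hy (hC x hx y hxy h)
  have hdis' : ∀ x, x ∈ C → g.symm x ∉ C := fun x hx hx' =>
    hdis _ hx' (by rwa [RelIso.apply_symm_apply])
  have hfix' : ∀ x, g.symm x ∈ C → ∀ y, g.symm y ∉ C → G.Adj x y → g.symm y = y := by
    intro x hx y hy hxy
    have := hfix _ hx _ hy (g.symm.map_adj_iff.2 hxy)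
    rw [RelIso.apply_symm_apply] at this
    exact this.symm
  let f : V → V := fun x => if x ∈ C then g x else if g.symm x ∈ C then g.symm x else x
  have hf₁ : ∀ x, x ∈ C → f x = g x := fun x hx => if_pos hx
  have hf₂ : ∀ x, g.symm x ∈ C → f x = g.symm x := fun x hx => by
    have : x ∉ C := fun h => hdis' x h hx
    simp [f, this, hx]
  have hf₃ : ∀ x, x ∉ C → g.symm x ∉ C → f x = x := fun x hx hx' => by simp [f, hx, hx']
  have hinv : ∀ x, f (f x) = x := by
    intro x
    by_cases hx : x ∈ C
    · rw [hf₁ x hx, hf₂ _ (by simpa using hx), RelIso.symm_apply_apply]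
    by_cases hx' : g.symm x ∈ C
    · rw [hf₂ x hx', hf₁ _ hx', RelIso.apply_symm_apply]
    · rw [hf₃ x hx hx', hf₃ x hx hx']
  have hleft : ∀ x y, x ∈ C → G.Adj x y → G.Adj (f x) (f y) := by
    intro x y hx hxy
    have hg : G.Adj (g x) (g y) := g.map_adj_iff.2 hxy
    rw [hf₁ x hx]
    by_cases hy : y ∈ C
    · rwa [hf₁ y hy]
    have hgy := hfix x hx y hy hxy
    have hy' : g.symm y = y := g.symm_apply_eq.2 hgy.symm
    rw [hf₃ y hy (by rwa [hy'])]
    rwa [hgy] at hg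
  have hright : ∀ x y, g.symm x ∈ C → y ∉ C → G.Adj x y → G.Adj (f x) (f y) := by
    intro x y hx hy hxy
    have hg : G.Adj (g.symm x) (g.symm y) := g.symm.map_adj_iff.2 hxy
    rw [hf₂ x hx]
    by_cases hy' : g.symm y ∈ C
    · rwa [hf₂ y hy']
    rw [hf₃ y hy hy']
    rwa [hfix' x hx y hy' hxy] at hg
  have hadj : ∀ x y, G.Adj x y → G.Adj (f x) (f y) := by
    intro x y hxy
    by_cases hx : x ∈ C
    · exact hleft x y hx hxy
    by_cases hy : y ∈ C
    · exact (hleft y x hy hxy.symm).symm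
    by_cases hx' : g.symm x ∈ C
    · exact hright x y hx' hy hxy
    by_cases hy' : g.symm y ∈ C
    · exact (hright y x hy' hx hxy.symm).symm
    rwa [hf₃ x hx hx', hf₃ y hy hy']
  exact ⟨isoOfInverseHoms f f hinv hinv hadj hadj, hf₁, hf₃⟩

/-- A set that meets a component of an induced subgraph and is closed under adjacency in that
subgraph contains the whole component. -/
theorem mem_of_mem_supp_of_adj_closed {V : Type*} {G : SimpleGraph V} {s : Set V}
    (c : (G.induce s).ConnectedComponent) (D : Set V)
    (hD : ∀ x ∈ D, ∀ y ∈ s, G.Adj x y → y ∈ D) {x y : s} (hx : x ∈ c.supp) (hy : y ∈ c.supp)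
    (hxD : (x : V) ∈ D) : (y : V) ∈ D := by
  have hxy : (G.induce s).Reachable x y := ConnectedComponent.exact (hx.trans hy.symm)
  obtain ⟨w⟩ := hxy
  clear hx hy
  induction w with
  | nil => exact hxD
  | @cons u v _ h _ ih => exact ih (hD u hxD v v.2 h)

/-- Let `G` be a connected, locally finite graph with infinite motion
and `g` an automorphism. Then every connected component of the graph obtained from `G`
by deleting the fixed vertices of `g` (with all incident edges) is infinite. -/
theorem stmt_13 {V : Type*} (G : SimpleGraph V) (hconn : G.Connected)
    (hlf : ∀ x : V, (G.neighborSet x).Finite) (hmot : InfiniteMotion G)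
    (g : G ≃g G) :
    ∀ c : (G.induce {x : V | g x ≠ x}).ConnectedComponent, c.supp.Infinite := by
  intro c hfin
  set C : Set V := Subtype.val '' c.supp
  have hCfin : C.Finite := hfin.image _
  have hmoved : ∀ x ∈ C, g x ≠ x := by
    rintro _ ⟨x, -, rfl⟩
    exact x.2
  have hC : ∀ x ∈ C, ∀ y, G.Adj x y → g y ≠ y → y ∈ C := by
    rintro _ ⟨x, hx, rfl⟩ y hxy hy
    have hadj : (G.induce {x : V | g x ≠ x}).Adj x ⟨y, hy⟩ := hxy
    exact ⟨⟨y, hy⟩, (ConnectedComponent.sound hadj.reachable.symm).trans hx, rfl⟩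
  have hsub : ∀ D : Set V, (∀ x ∈ D, ∀ y, G.Adj x y → g y ≠ y → y ∈ D) →
      ∀ x ∈ C, x ∈ D → C ⊆ D := by
    rintro D hD _ ⟨x, hx, rfl⟩ hxD _ ⟨y, hy, rfl⟩
    exact mem_of_mem_supp_of_adj_closed c D (fun x hx y hy hxy => hD x hx y hxy hy) hx hy hxD
  obtain ⟨v, hv⟩ : C.Nonempty := c.nonempty_supp.image _
  by_cases hdis : ∀ x ∈ C, g x ∉ C
  · obtain ⟨h, h₁, h₂⟩ := exists_iso_swap_of_disjoint g C hC hdis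
    refine hmot h ⟨v, by rw [h₁ v hv]; exact hmoved v hv⟩
      ((hCfin.union (hCfin.image g)).subset fun x hx => ?_)
    by_contra hx'
    rw [Set.mem_union, not_or] at hx'
    exact hx (h₂ x hx'.1 fun h' => hx'.2 ⟨_, h', g.apply_symm_apply x⟩)
  · push Not at hdis
    obtain ⟨u, hu, hgu⟩ := hdis
    have hpre : C ⊆ g ⁻¹' C := hsub _ (fun x hx y hxy hy =>
      hC _ hx _ (g.map_adj_iff.2 hxy) (g.injective.ne hy)) u hu hgu
    have himg : C ⊆ g.symm ⁻¹' C := hsub _ (fun x hx y hxy hy =>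
      hC _ hx _ (g.symm.map_adj_iff.2 hxy) (by
        rw [g.apply_symm_apply]
        exact fun h => hy (g.symm_apply_eq.1 h.symm).symm)) (g u) hgu
        (by simpa using hu)
    obtain ⟨h, h₁, h₂⟩ := exists_iso_eq_on_of_invariant g C hC
      fun x => ⟨fun hx => by simpa using himg hx, fun hx => hpre hx⟩
    refine hmot h ⟨v, by rw [h₁ v hv]; exact hmoved v hv⟩ (hCfin.subset fun x hx => ?_)
    by_contra hx'
    exact hx (h₂ x hx')
end
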